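/- arXiv:1407.1349 — 2 statements merged into one kernel-verified Lean document; each statement's English description precedes it below -/
import Mathlib

section
/- Let 0 ≠ T = (T_n) ∈ A and let ε > 0. Then there exists m₀ ∈ ℕ such that for every λ ∈ ℂ with |λ| > 4 p(T) ε and |λ| > ε: if λ is not in the spectrum of T_n for every n < m₀, then λI − T_n is invertible in M_n(ℂ) for every n ≥ 1 and sup_n p_n((λI − T_n)^{-1}) < ∞. -/
noncomputable section

/-- The operator norm on `M_n(ℂ)` acting on `ℓ²(Fin n)`. -/
def opNorm {n : ℕ} (x : Matrix (Fin n) (Fin n) ℂ) : ℝ :=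
  ‖LinearMap.toContinuousLinearMap (Matrix.toEuclideanLin x)‖

/-- The diagonal matrix `d_n` whose `k`-th diagonal entry is `c_n ^ k` (for `1 ≤ k ≤ n`). -/
def dMat (c : ℕ → ℝ) (n : ℕ) : Matrix (Fin n) (Fin n) ℂ :=
  Matrix.diagonal fun k => ((c n ^ ((k : ℕ) + 1) : ℝ) : ℂ)

/-- The inverse `d_n⁻¹`. -/
def dMatInv (c : ℕ → ℝ) (n : ℕ) : Matrix (Fin n) (Fin n) ℂ :=
  Matrix.diagonal fun k => (((c n ^ ((k : ℕ) + 1))⁻¹ : ℝ) : ℂ)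

/-- The norm `p_n(x) = max {‖x‖, ‖d_n x d_n⁻¹‖}`. -/
def pnorm (c : ℕ → ℝ) (n : ℕ) (x : Matrix (Fin n) (Fin n) ℂ) : ℝ :=
  max (opNorm x) (opNorm (dMat c n * x * dMatInv c n))

/-- The left shift `L_n`: `L_n e_{k+1} = e_k`, `L_n e_1 = 0`. -/
def Lmat (n : ℕ) : Matrix (Fin n) (Fin n) ℂ :=
  Matrix.of fun i j => if (i : ℕ) + 1 = (j : ℕ) then 1 else 0

/-- The integer interval `E_{n,k} = {i ∈ ℕ : n/k ≤ i ≤ 2n/k}`. -/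
def Eset (n k : ℕ) : Finset ℕ :=
  (Finset.range (2 * n + 1)).filter fun i => (n : ℝ) / k ≤ i ∧ (i : ℝ) ≤ 2 * n / k

/-- `u_{n,k} = μ_{n,k}⁻¹ ∑_{i ∈ E_{n,k}} L_n^i` if `k ≤ n`, and `u_{n,k} = I_n` if `n < k`. -/
def umat (n k : ℕ) : Matrix (Fin n) (Fin n) ℂ :=
  if k ≤ n then ((Eset n k).card : ℂ)⁻¹ • ∑ i ∈ Eset n k, Lmat n ^ i else 1

/-- Membership in the algebra `A`: `p(T) < ∞` and
`sup_n p_n(T_n u_{n,k} − T_n) + sup_n p_n(u_{n,k} T_n − T_n) → 0` as `k → ∞`. -/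
def memA (c : ℕ → ℝ) (T : ∀ n, Matrix (Fin n) (Fin n) ℂ) : Prop :=
  (∃ M : ℝ, ∀ n, pnorm c n (T n) ≤ M) ∧
  ∀ ε : ℝ, 0 < ε → ∃ K : ℕ, ∀ k, K ≤ k → ∀ n,
    pnorm c n (T n * umat n k - T n) + pnorm c n (umat n k * T n - T n) ≤ ε

/-- `p(T) = sup_n p_n(T_n)`. -/
def pA (c : ℕ → ℝ) (T : ∀ n, Matrix (Fin n) (Fin n) ℂ) : ℝ :=
  ⨆ n, pnorm c n (T n)

/-- The upper triangular part `Δ̄_U x`. -/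
def upperT {n : ℕ} (x : Matrix (Fin n) (Fin n) ℂ) : Matrix (Fin n) (Fin n) ℂ :=
  Matrix.of fun i j => if i ≤ j then x i j else 0

/-- The strictly lower triangular part `Δ_L x`. -/
def lowerT {n : ℕ} (x : Matrix (Fin n) (Fin n) ℂ) : Matrix (Fin n) (Fin n) ℂ :=
  Matrix.of fun i j => if j < i then x i j else 0

section Helpers

open scoped Matrix.Norms.L2Operator
open Matrix

variable {n : ℕ}

lemma opNorm_eq_norm (x : Matrix (Fin n) (Fin n) ℂ) : opNorm x = ‖x‖ := rfl

lemma norm_one_matrix_le : ‖(1 : Matrix (Fin n) (Fin n) ℂ)‖ ≤ 1 := by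
  rw [← diagonal_one, l2_opNorm_diagonal]
  exact (pi_norm_le_iff_of_nonneg zero_le_one).2 fun i => by simp

lemma norm_pow_matrix_le (x : Matrix (Fin n) (Fin n) ℂ) (k : ℕ) : ‖x ^ k‖ ≤ ‖x‖ ^ k := by
  rcases k.eq_zero_or_pos with rfl | hk
  · simpa using norm_one_matrix_le
  · exact norm_pow_le' x hk

lemma norm_entry_le_norm (x : Matrix (Fin n) (Fin n) ℂ) (i j : Fin n) : ‖x i j‖ ≤ ‖x‖ := by
  have h := x.l2_opNorm_mulVec (EuclideanSpace.single j (1 : ℂ))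
  rw [PiLp.norm_single, norm_one, mul_one] at h
  refine le_trans ?_ h
  refine le_trans (le_of_eq ?_) (PiLp.norm_apply_le _ i)
  simp

/-- A matrix with at most one nonzero entry in each row and column has norm at most any bound on
its entries. -/
lemma norm_le_of_monomial (y : Matrix (Fin n) (Fin n) ℂ) {b : ℝ} (hb : 0 ≤ b)
    (hrow : ∀ i j j', y i j ≠ 0 → y i j' ≠ 0 → j = j')
    (hcol : ∀ i i' j, y i j ≠ 0 → y i' j ≠ 0 → i = i')
    (hy : ∀ i j, ‖y i j‖ ≤ b) : ‖y‖ ≤ b := by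
  have hdiag : yᴴ * y = diagonal fun j => ∑ i, star (y i j) * y i j := by
    ext j j'
    rw [mul_apply, diagonal_apply]
    split_ifs with h
    · subst h
      simp [conjTranspose_apply]
    · refine Finset.sum_eq_zero fun i _ => ?_
      by_contra hne
      rw [conjTranspose_apply] at hne
      exact h (hrow i j j' (fun h0 => hne (by simp [h0])) (fun h0 => hne (by simp [h0])))
  have hsq : ‖y‖ * ‖y‖ ≤ b * b := by
    rw [← l2_opNorm_conjTranspose_mul_self, hdiag, l2_opNorm_diagonal]
    refine (pi_norm_le_iff_of_nonneg (by positivity)).2 fun j => ?_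
    by_cases h : ∃ i, y i j ≠ 0
    · obtain ⟨i, hi⟩ := h
      rw [Finset.sum_eq_single i]
      · rw [norm_mul, norm_star]
        exact mul_le_mul (hy i j) (hy i j) (norm_nonneg _) hb
      · intro i' _ hne
        by_cases h0 : y i' j = 0
        · simp [h0]
        · exact absurd (hcol i' i j h0 hi) hne
      · simp
    · push Not at h
      simp only [h, mul_zero, Finset.sum_const_zero, norm_zero]
      positivity
  exact abs_le_of_sq_le_sq' (by nlinarith) hb |>.2

lemma norm_Lmat_le : ‖Lmat n‖ ≤ 1 := by
  refine norm_le_of_monomial _ zero_le_one ?_ ?_ ?_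
  · intro i j j' h h'
    simp only [Lmat, of_apply, ne_eq, ite_eq_right_iff, one_ne_zero, imp_false, not_not] at h h'
    exact Fin.ext (by omega)
  · intro i i' j h h'
    simp only [Lmat, of_apply, ne_eq, ite_eq_right_iff, one_ne_zero, imp_false, not_not] at h h'
    exact Fin.ext (by omega)
  · intro i j
    simp only [Lmat, of_apply]
    split_ifs <;> simp

/-- `x` vanishes strictly below the `r`-th superdiagonal. -/
def IsAboveBand (r : ℕ) (x : Matrix (Fin n) (Fin n) ℂ) : Prop :=
  ∀ i j : Fin n, (j : ℕ) < i + r → x i j = 0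

lemma IsAboveBand.mul {r s : ℕ} {x y : Matrix (Fin n) (Fin n) ℂ} (hx : IsAboveBand r x)
    (hy : IsAboveBand s y) : IsAboveBand (r + s) (x * y) := by
  intro i j hij
  rw [mul_apply]
  refine Finset.sum_eq_zero fun l _ => ?_
  by_cases h : (l : ℕ) < i + r
  · rw [hx i l h, zero_mul]
  · rw [hy l j (by omega), mul_zero]

lemma isAboveBand_one : IsAboveBand 0 (1 : Matrix (Fin n) (Fin n) ℂ) := by
  intro i j hij
  exact one_apply_ne (fun h => by subst h; omega)

lemma IsAboveBand.pow {r : ℕ} {x : Matrix (Fin n) (Fin n) ℂ} (hx : IsAboveBand r x) (k : ℕ) :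
    IsAboveBand (k * r) (x ^ k) := by
  induction k with
  | zero => simpa using isAboveBand_one
  | succ k ih => rw [pow_succ, Nat.succ_mul]; exact ih.mul hx

lemma IsAboveBand.mono {r s : ℕ} {x : Matrix (Fin n) (Fin n) ℂ} (hx : IsAboveBand s x)
    (hrs : r ≤ s) : IsAboveBand r x :=
  fun i j h => hx i j (by omega)

lemma IsAboveBand.eq_zero {r : ℕ} {x : Matrix (Fin n) (Fin n) ℂ} (hx : IsAboveBand r x)
    (hr : n ≤ r) : x = 0 := by
  ext i j
  exact hx i j (by omega)

lemma isAboveBand_Lmat : IsAboveBand 1 (Lmat n) := by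
  intro i j hij
  simp only [Lmat, of_apply]
  rw [if_neg (by omega)]

lemma isAboveBand_zero_iff {x : Matrix (Fin n) (Fin n) ℂ} :
    IsAboveBand 0 x ↔ x.BlockTriangular id :=
  ⟨fun h _ _ hij => h _ _ hij, fun h _ _ hij => h (Fin.lt_def.2 hij)⟩

lemma mem_Eset_bounds {k : ℕ} (hk : 0 < k) {i : ℕ} (hi : i ∈ Eset n k) : n ≤ k * i := by
  have h := ((Finset.mem_filter.1 hi).2).1
  rw [div_le_iff₀ (by exact_mod_cast hk)] at h
  rw [mul_comm]
  exact_mod_cast h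

lemma isAboveBand_umat {k : ℕ} (hk : 0 < k) (hkn : k ≤ n) :
    ∃ r, n ≤ k * r ∧ IsAboveBand r (umat n k) := by
  by_cases hne : (Eset n k).Nonempty
  · refine ⟨(Eset n k).min' hne, mem_Eset_bounds hk (Finset.min'_mem _ _), ?_⟩
    intro i j hij
    rw [umat, if_pos hkn, Matrix.smul_apply, Matrix.sum_apply]
    rw [Finset.sum_eq_zero, smul_zero]
    intro m hm
    refine (isAboveBand_Lmat.pow m) i j ?_
    have := Finset.min'_le _ _ hm
    omega
  · refine ⟨n, Nat.le_mul_of_pos_left n hk, ?_⟩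
    intro i j _
    rw [umat, if_pos hkn, Finset.not_nonempty_iff_eq_empty.1 hne]
    simp

lemma norm_average_le (s : Finset ℕ) (f : ℕ → Matrix (Fin n) (Fin n) ℂ) {b : ℝ} (hb : 0 ≤ b)
    (hf : ∀ i ∈ s, ‖f i‖ ≤ b) : ‖(s.card : ℂ)⁻¹ • ∑ i ∈ s, f i‖ ≤ b := by
  rcases s.eq_empty_or_nonempty with rfl | hs
  · simpa using hb
  · have hc : (0 : ℝ) < s.card := by exact_mod_cast hs.card_pos
    rw [norm_smul, norm_inv, Complex.norm_natCast, inv_mul_le_iff₀ hc]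
    refine (norm_sum_le _ _).trans ((Finset.sum_le_sum hf).trans ?_)
    simp

lemma dMat_mul_dMatInv {c : ℕ → ℝ} (hc : 1 < c n) : dMat c n * dMatInv c n = 1 := by
  rw [dMat, dMatInv, diagonal_mul_diagonal, ← diagonal_one]
  congr 1
  ext k
  rw [← Complex.ofReal_mul, mul_inv_cancel₀ (by positivity), Complex.ofReal_one]

lemma dMatInv_mul_dMat {c : ℕ → ℝ} (hc : 1 < c n) : dMatInv c n * dMat c n = 1 :=
  mul_eq_one_comm.1 (dMat_mul_dMatInv hc)

lemma dMat_conj_apply (c : ℕ → ℝ) (x : Matrix (Fin n) (Fin n) ℂ) (i j : Fin n) :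
    (dMat c n * x * dMatInv c n) i j =
      ((c n ^ ((i : ℕ) + 1) : ℝ) : ℂ) * x i j * (((c n ^ ((j : ℕ) + 1))⁻¹ : ℝ) : ℂ) := by
  rw [dMat, dMatInv, mul_diagonal, diagonal_mul]

lemma dMat_conj_mul {c : ℕ → ℝ} (hc : 1 < c n) (x y : Matrix (Fin n) (Fin n) ℂ) :
    dMat c n * (x * y) * dMatInv c n =
      (dMat c n * x * dMatInv c n) * (dMat c n * y * dMatInv c n) := by
  calc _ = dMat c n * x * 1 * y * dMatInv c n := by simp only [mul_one, mul_assoc]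
    _ = _ := by rw [← dMatInv_mul_dMat hc]; simp only [mul_assoc]

lemma dMat_conj_Lmat_pow {c : ℕ → ℝ} (hc : 1 < c n) (i : ℕ) :
    dMat c n * Lmat n ^ i * dMatInv c n = (((c n)⁻¹ : ℝ) : ℂ) ^ i • Lmat n ^ i := by
  induction i with
  | zero => simp [dMat_mul_dMatInv hc]
  | succ i ih =>
    have h1 : dMat c n * Lmat n * dMatInv c n = (((c n)⁻¹ : ℝ) : ℂ) • Lmat n := by
      ext a b
      rw [dMat_conj_apply, Matrix.smul_apply, Lmat, of_apply]
      have h0 : (c n : ℂ) ≠ 0 := by exact_mod_cast (zero_lt_one.trans hc).ne'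
      split_ifs with h
      · rw [← h]
        push_cast
        rw [smul_eq_mul]
        field_simp
        ring
      · simp
    rw [pow_succ, dMat_conj_mul hc, ih, h1, smul_mul_smul_comm, pow_succ]

lemma norm_Lmat_pow_le (i : ℕ) : ‖Lmat n ^ i‖ ≤ 1 :=
  (norm_pow_matrix_le _ _).trans (pow_le_one₀ (norm_nonneg _) norm_Lmat_le)

lemma norm_umat_le {k : ℕ} (hkn : k ≤ n) : ‖umat n k‖ ≤ 1 := by
  rw [umat, if_pos hkn]
  exact norm_average_le _ _ zero_le_one fun i _ => norm_Lmat_pow_le i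

lemma norm_conj_umat_le {c : ℕ → ℝ} (hc : 1 < c n) {k : ℕ} (hk : 0 < k) (hkn : k ≤ n) :
    ‖dMat c n * umat n k * dMatInv c n‖ ≤ (c n)⁻¹ := by
  have hc0 : 0 < c n := zero_lt_one.trans hc
  rw [umat, if_pos hkn, mul_smul_comm, smul_mul_assoc, Finset.mul_sum, Finset.sum_mul]
  refine norm_average_le _ _ (by positivity) fun i hi => ?_
  have hi1 : i ≠ 0 := by
    rintro rfl
    have := mem_Eset_bounds hk hi
    omega
  rw [dMat_conj_Lmat_pow hc, norm_smul, norm_pow, Complex.norm_real, Real.norm_of_nonneg (by positivity)]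
  calc (c n)⁻¹ ^ i * ‖Lmat n ^ i‖ ≤ (c n)⁻¹ * 1 := by
        gcongr
        · exact pow_le_of_le_one (by positivity) (inv_le_one_of_one_le₀ hc.le) hi1
        · exact norm_Lmat_pow_le i
    _ = _ := mul_one _

lemma upperT_add_lowerT (x : Matrix (Fin n) (Fin n) ℂ) : upperT x + lowerT x = x := by
  ext i j
  simp only [Matrix.add_apply, upperT, lowerT, of_apply]
  rcases lt_or_ge j i with h | h
  · simp [h, h.not_ge]
  · simp [h, h.not_gt]

lemma isAboveBand_upperT (x : Matrix (Fin n) (Fin n) ℂ) : IsAboveBand 0 (upperT x) := by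
  intro i j hij
  rw [upperT, of_apply, if_neg (by simpa using hij)]

lemma norm_lowerT_le {c : ℕ → ℝ} (hc : 2 ≤ c n) {x : Matrix (Fin n) (Fin n) ℂ} {M : ℝ}
    (hM : ‖dMat c n * x * dMatInv c n‖ ≤ M) : ‖lowerT x‖ ≤ 2 * M / c n := by
  have hc0 : 0 < c n := by linarith
  have hM0 : 0 ≤ M := (norm_nonneg _).trans hM
  set D : ℕ → Matrix (Fin n) (Fin n) ℂ := fun m =>
    of fun i j => if (i : ℕ) = j + (m + 1) then x i j else 0 with hD
  have hsum : lowerT x = ∑ m ∈ Finset.range n, D m := by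
    ext i j
    simp only [lowerT, hD, Matrix.sum_apply, of_apply]
    split_ifs with h
    · have h' : (j : ℕ) < i := h
      rw [Finset.sum_eq_single ((i : ℕ) - j - 1)]
      · rw [if_pos (by omega)]
      · intro m _ hm
        rw [if_neg (by omega)]
      · intro hm
        exact absurd (Finset.mem_range.2 (by omega)) hm
    · refine (Finset.sum_eq_zero fun m _ => if_neg fun hm => h (Fin.lt_def.2 (by omega))).symm
  have hDm : ∀ m, ‖D m‖ ≤ M * (c n)⁻¹ ^ (m + 1) := by
    intro m
    have hne : ∀ i j, D m i j ≠ 0 → (i : ℕ) = j + (m + 1) := by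
      intro i j h
      by_contra h'
      exact h (by simp only [hD, of_apply, if_neg h'])
    refine norm_le_of_monomial _ (by positivity) ?_ ?_ ?_
    · intro i j j' h h'
      have := hne _ _ h
      have := hne _ _ h'
      exact Fin.ext (by omega)
    · intro i i' j h h'
      have := hne _ _ h
      have := hne _ _ h'
      exact Fin.ext (by omega)
    · intro i j
      simp only [hD, of_apply]
      split_ifs with h
      · have he := (norm_entry_le_norm _ i j).trans hM
        rw [dMat_conj_apply, norm_mul, norm_mul, Complex.norm_real, Complex.norm_real,
          Real.norm_of_nonneg (by positivity), Real.norm_of_nonneg (by positivity), h] at he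
        rw [inv_pow, ← div_eq_mul_inv, le_div_iff₀ (by positivity)]
        calc ‖x i j‖ * c n ^ (m + 1)
            = c n ^ ((j : ℕ) + (m + 1) + 1) * ‖x i j‖ * (c n ^ ((j : ℕ) + 1))⁻¹ := by
              field_simp
              ring
          _ ≤ M := he
      · rw [norm_zero]
        positivity
  have hinv : (c n)⁻¹ ≤ 1 / 2 := by
    rw [inv_le_comm₀ hc0 (by norm_num)]
    simpa using hc
  have hinv0 : 0 < (c n)⁻¹ := by positivity
  calc ‖lowerT x‖ ≤ ∑ m ∈ Finset.range n, M * (c n)⁻¹ ^ (m + 1) := by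
        rw [hsum]
        exact norm_sum_le_of_le _ fun m _ => hDm m
    _ = M * (c n)⁻¹ * ∑ m ∈ Finset.range n, (c n)⁻¹ ^ m := by
        rw [Finset.mul_sum]
        refine Finset.sum_congr rfl fun m _ => ?_
        ring
    _ ≤ M * (c n)⁻¹ * 2 := by
        gcongr
        have hg := geom_sum_mul_neg (c n)⁻¹ n
        have hp : 0 ≤ (c n)⁻¹ ^ n := by positivity
        have hs : 0 ≤ ∑ m ∈ Finset.range n, (c n)⁻¹ ^ m := by positivity
        nlinarith
    _ = 2 * M / c n := by ring

lemma exists_left_inverse_of_norm_le {E : Matrix (Fin n) (Fin n) ℂ} {lam : ℂ} {δ : ℝ}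
    (hE : ‖E‖ ≤ δ) (hlam : δ < ‖lam‖) :
    ∃ R, R * (lam • 1 - E) = 1 ∧ ‖R‖ ≤ (‖lam‖ - δ)⁻¹ := by
  have hu : IsUnit (lam • (1 : Matrix (Fin n) (Fin n) ℂ) - E) := by
    have h : lam ∈ resolventSet ℂ E := by
      refine spectrum.mem_resolventSet_of_norm_lt_mul (lt_of_le_of_lt ?_ hlam)
      calc ‖E‖ * ‖(1 : Matrix (Fin n) (Fin n) ℂ)‖ ≤ ‖E‖ * 1 := by
            gcongr
            exact norm_one_matrix_le
        _ ≤ δ := by rwa [mul_one]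
    rwa [spectrum.mem_resolventSet_iff, Algebra.algebraMap_eq_smul_one] at h
  obtain ⟨R, hR⟩ := hu.exists_left_inv
  refine ⟨R, hR, ?_⟩
  have hR' : lam • R = 1 + R * E := by
    rw [← hR, mul_sub, mul_smul_comm, mul_one, sub_add_cancel]
  have h1 : ‖lam‖ * ‖R‖ ≤ 1 + ‖R‖ * δ := by
    rw [← norm_smul, hR']
    refine (norm_add_le _ _).trans (add_le_add norm_one_matrix_le ?_)
    exact (norm_mul_le _ _).trans (by gcongr)
  have hpos : 0 < ‖lam‖ - δ := by linarith
  rw [← one_div, le_div_iff₀ hpos]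
  linarith

lemma exists_left_inverse_of_perturbation {A F R : Matrix (Fin n) (Fin n) ℂ} {B : ℝ}
    (hRA : R * A = 1) (hR : ‖R‖ ≤ B) (hF : B * ‖F‖ ≤ 1 / 2) :
    ∃ S, S * (A - F) = 1 ∧ ‖S‖ ≤ 2 * B := by
  have hRF : ‖R * F‖ ≤ 1 / 2 := (norm_mul_le _ _).trans ((by gcongr : _ ≤ B * ‖F‖).trans hF)
  obtain ⟨Q, hQ, hQn⟩ := exists_left_inverse_of_norm_le (lam := 1) hRF (by norm_num)
  refine ⟨Q * R, ?_, ?_⟩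
  · rw [one_smul] at hQ
    rw [mul_assoc, mul_sub, hRA, hQ]
  · refine (norm_mul_le _ _).trans (mul_le_mul (hQn.trans ?_) hR (norm_nonneg _) zero_le_two)
    norm_num

/-- The resolvent of an upper triangular matrix which is close to its product with a matrix supported
far above the diagonal. -/
lemma exists_left_inverse_of_upper {U u : Matrix (Fin n) (Fin n) ℂ} {lam : ℂ} {ε K : ℝ} {k r : ℕ}
    (hU : IsAboveBand 0 U) (hu : IsAboveBand r u) (hkr : n ≤ k * r) (hε : 0 < ε)
    (hlam : ε < ‖lam‖) (hE : ‖U - U * u‖ ≤ ε / 2) (hK : ‖U * u‖ ≤ K) :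
    ∃ R, R * (lam • 1 - U) = 1 ∧ ‖R‖ ≤ (∑ j ∈ Finset.range k, (2 / ε * K) ^ j) * (2 / ε) := by
  obtain ⟨R, hR, hRn⟩ := exists_left_inverse_of_norm_le hE (lam := lam) (by linarith)
  have hK0 : 0 ≤ K := (norm_nonneg _).trans hK
  have hRn' : ‖R‖ ≤ 2 / ε := by
    refine hRn.trans ?_
    rw [← inv_div ε 2]
    exact inv_anti₀ (by positivity) (by linarith)
  have hu0 : IsAboveBand 0 u := hu.mono (Nat.zero_le r)
  have hE0 : (lam • 1 - (U - U * u)).BlockTriangular id := by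
    have h1 := isAboveBand_zero_iff.1 hU
    have h2 := isAboveBand_zero_iff.1 hu0
    have h3 : (lam • (1 : Matrix (Fin n) (Fin n) ℂ)).BlockTriangular id := by
      rw [← Algebra.algebraMap_eq_smul_one]
      exact blockTriangular_algebraMap lam
    exact h3.sub (h1.sub (h1.mul h2))
  have hR0 : IsAboveBand 0 R := by
    let _ : Invertible (lam • 1 - (U - U * u)) := ⟨R, hR, mul_eq_one_comm.1 hR⟩
    rw [isAboveBand_zero_iff, ← inv_eq_left_inv hR]
    exact blockTriangular_inv_of_blockTriangular hE0
  set N := R * (U * u) with hN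
  have hNband : IsAboveBand r N := by
    have := hR0.mul (hU.mul hu)
    simpa using this
  have hNk : N ^ k = 0 := (hNband.pow k).eq_zero hkr
  have hNn : ‖N‖ ≤ 2 / ε * K :=
    (norm_mul_le _ _).trans (mul_le_mul hRn' hK (norm_nonneg _) (by positivity))
  refine ⟨(∑ j ∈ Finset.range k, N ^ j) * R, ?_, ?_⟩
  · have h1 : R * (lam • 1 - U) = 1 - N := by
      rw [eq_sub_iff_add_eq, hN, ← mul_add, sub_add]
      exact hR
    rw [mul_assoc, h1, geom_sum_mul_neg, hNk, sub_zero]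
  · refine (norm_mul_le _ _).trans (mul_le_mul ?_ hRn' (norm_nonneg _) (by positivity))
    refine norm_sum_le_of_le _ fun j _ => (norm_pow_matrix_le _ _).trans ?_
    gcongr

/-- The resolvent bound in `M_n(ℂ)`, valid as soon as `n` and `c n` are large. -/
lemma resolvent_bound_of_large {c : ℕ → ℝ} {x : Matrix (Fin n) (Fin n) ℂ} {M ε B : ℝ} {k : ℕ}
    (hε : 0 < ε) (hk : 0 < k) (hkn : k ≤ n) (hc : 2 ≤ c n)
    (hM : pnorm c n x ≤ M) (hx : pnorm c n (x * umat n k - x) ≤ ε / 4)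
    (hB : B = (∑ j ∈ Finset.range k, (2 / ε * (M + 1)) ^ j) * (2 / ε))
    (hc1 : 2 * M / c n ≤ 1) (hc2 : 2 * M / c n ≤ ε / 8) (hc3 : B * (2 * M / c n) ≤ 1 / 2)
    {lam : ℂ} (hlam : ε < ‖lam‖) :
    IsUnit (lam • (1 : Matrix (Fin n) (Fin n) ℂ) - x) ∧
      pnorm c n (lam • (1 : Matrix (Fin n) (Fin n) ℂ) - x)⁻¹ ≤ max (2 * B) (2 / ε) := by
  have hc1' : 1 < c n := by linarith
  obtain ⟨hMx, hMd⟩ := max_le_iff.1 hM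
  obtain ⟨hxx, hxd⟩ := max_le_iff.1 hx
  rw [opNorm_eq_norm] at hMx hMd hxx hxd
  set u := umat n k with hu
  have hun : ‖u‖ ≤ 1 := norm_umat_le hkn
  obtain ⟨r, hr, hband⟩ := isAboveBand_umat hk hkn
  have hlow := norm_lowerT_le hc hMd
  have hUx : upperT x = x - lowerT x := eq_sub_of_add_eq (upperT_add_lowerT x)
  have hlu : ‖lowerT x * u‖ ≤ 2 * M / c n :=
    (norm_mul_le _ _).trans ((mul_le_of_le_one_right (norm_nonneg _) hun).trans hlow)
  have hxu : ‖x * u‖ ≤ M :=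
    (norm_mul_le _ _).trans ((mul_le_of_le_one_right (norm_nonneg _) hun).trans hMx)
  have hE : ‖upperT x - upperT x * u‖ ≤ ε / 2 := by
    have : upperT x - upperT x * u = -(x * u - x) - lowerT x + lowerT x * u := by
      rw [hUx, sub_mul]
      abel
    rw [this]
    refine (norm_add_le _ _).trans ?_
    have := norm_sub_le (-(x * u - x)) (lowerT x)
    rw [norm_neg] at this
    linarith
  have hKu : ‖upperT x * u‖ ≤ M + 1 := by
    rw [hUx, sub_mul]
    refine (norm_sub_le _ _).trans ?_
    linarith
  obtain ⟨R, hR, hRn⟩ :=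
    exists_left_inverse_of_upper (isAboveBand_upperT x) hband hr hε hlam hE hKu
  rw [← hB] at hRn
  have hB0 : 0 ≤ B := (norm_nonneg _).trans hRn
  obtain ⟨S, hS, hSn⟩ := exists_left_inverse_of_perturbation (F := lowerT x) hR hRn
    ((by gcongr : B * ‖lowerT x‖ ≤ B * (2 * M / c n)).trans hc3)
  rw [sub_sub, upperT_add_lowerT] at hS
  have hinv := inv_eq_left_inv hS
  refine ⟨IsUnit.of_mul_eq_one_right S hS, ?_⟩
  rw [hinv]
  refine max_le_max hSn ?_
  rw [opNorm_eq_norm]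
  set y := dMat c n * x * dMatInv c n with hy
  have hyn : ‖y‖ ≤ ε / 2 := by
    have hv := norm_conj_umat_le hc1' hk hkn
    have hv2 : ‖dMat c n * u * dMatInv c n‖ ≤ 1 / 2 := by
      refine hv.trans ?_
      rw [inv_le_comm₀ (by linarith) (by norm_num)]
      simpa using hc
    rw [mul_sub, sub_mul, dMat_conj_mul hc1', ← hy] at hxd
    have h1 : ‖y * (dMat c n * u * dMatInv c n)‖ ≤ ‖y‖ * (1 / 2) :=
      (norm_mul_le _ _).trans (by gcongr)
    have h2 := norm_sub_le (y * (dMat c n * u * dMatInv c n))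
      (y * (dMat c n * u * dMatInv c n) - y)
    rw [sub_sub_cancel] at h2
    linarith
  obtain ⟨Q, hQ, hQn⟩ := exists_left_inverse_of_norm_le hyn (lam := lam) (by linarith)
  have hconj : (dMat c n * S * dMatInv c n) * (lam • 1 - y) = 1 := by
    have h1 : lam • 1 - y = dMat c n * (lam • 1 - x) * dMatInv c n := by
      rw [mul_sub, sub_mul, mul_smul_comm, smul_mul_assoc, mul_one, dMat_mul_dMatInv hc1']
    rw [h1, ← dMat_conj_mul hc1', hS, mul_one, dMat_mul_dMatInv hc1']
  have hSQ : dMat c n * S * dMatInv c n = Q := by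
    rw [← inv_eq_left_inv hconj, inv_eq_left_inv hQ]
  rw [hSQ]
  refine hQn.trans ?_
  rw [← inv_div ε 2]
  exact inv_anti₀ (by positivity) (by linarith)

lemma isUnit_of_not_hasEigenvalue {x : Matrix (Fin n) (Fin n) ℂ} {lam : ℂ}
    (h : ¬ Module.End.HasEigenvalue (Matrix.toLin' x) lam) :
    IsUnit (lam • (1 : Matrix (Fin n) (Fin n) ℂ) - x) := by
  rw [Module.End.hasEigenvalue_iff_mem_spectrum, Matrix.spectrum_toLin', spectrum.mem_iff,
    not_not, Algebra.algebraMap_eq_smul_one] at h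
  exact h

lemma pnorm_nonneg (c : ℕ → ℝ) (x : Matrix (Fin n) (Fin n) ℂ) : 0 ≤ pnorm c n x :=
  (norm_nonneg x).trans (le_max_left _ _)

end Helpers

/-- Let `0 ≠ T = (T_n) ∈ A` and `ε > 0`.  Then there exists `m₀ ∈ ℕ` such
that for every `λ ∈ ℂ` with `|λ| > 4 p(T) ε` and `|λ| > ε`: if `λ` is not an eigenvalue of
`T_n` for every `n < m₀`, then `λI − T_n` is invertible in `M_n(ℂ)` for every `n` and
`sup_n p_n((λI − T_n)⁻¹) < ∞`. -/
theorem stmt13 (c : ℕ → ℝ) (hmono : StrictMono c) (hone : ∀ n, 1 < c n)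
    (hunbdd : ∀ M : ℝ, ∃ n, M < c n)
    (T : ∀ n, Matrix (Fin n) (Fin n) ℂ) (hT : memA c T) (hT0 : T ≠ 0)
    (ε : ℝ) (hε : 0 < ε) :
    ∃ m₀ : ℕ, ∀ lam : ℂ, 4 * pA c T * ε < ‖lam‖ → ε < ‖lam‖ →
      (∀ n, n < m₀ → ¬ Module.End.HasEigenvalue (Matrix.toLin' (T n)) lam) →
      (∀ n : ℕ, IsUnit (lam • (1 : Matrix (Fin n) (Fin n) ℂ) - T n)) ∧
      ∃ M : ℝ, ∀ n : ℕ,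
        pnorm c n ((lam • (1 : Matrix (Fin n) (Fin n) ℂ) - T n)⁻¹) ≤ M := by
  obtain ⟨⟨M, hM⟩, hA⟩ := hT
  obtain ⟨K, hK⟩ := hA (ε / 4) (by positivity)
  set k := K + 1 with hk
  have hM0 : 0 ≤ M := (pnorm_nonneg c (T 0)).trans (hM 0)
  set B := (∑ j ∈ Finset.range k, (2 / ε * (M + 1)) ^ j) * (2 / ε) with hB
  have hB0 : 0 ≤ B := by positivity
  obtain ⟨n₁, hn₁⟩ := hunbdd (2 + 2 * M + 16 * M / ε + 4 * B * M)
  refine ⟨max n₁ k, fun lam _ hlam hev => ?_⟩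
  have hlarge : ∀ n, max n₁ k ≤ n → IsUnit (lam • (1 : Matrix (Fin n) (Fin n) ℂ) - T n) ∧
      pnorm c n (lam • (1 : Matrix (Fin n) (Fin n) ℂ) - T n)⁻¹ ≤ max (2 * B) (2 / ε) := by
    intro n hn
    have hcn : 2 + 2 * M + 16 * M / ε + 4 * B * M < c n :=
      hn₁.trans_le (hmono.monotone ((le_max_left _ _).trans hn))
    have h16 : 0 ≤ 16 * M / ε := by positivity
    have h4 : 0 ≤ 4 * B * M := by positivity
    have hc0 : 0 < c n := zero_lt_one.trans (hone n)
    refine resolvent_bound_of_large hε (Nat.succ_pos K) ((le_max_right _ _).trans hn)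
      (by linarith) (hM n) ?_ hB ?_ ?_ ?_ hlam
    · have := hK k (Nat.le_succ K) n
      have := pnorm_nonneg c (umat n k * T n - T n)
      linarith
    · rw [div_le_one hc0]
      linarith
    · rw [div_le_iff₀ hc0]
      have h : 16 * M / ε * ε = 16 * M := div_mul_cancel₀ _ hε.ne'
      have h' : 16 * M / ε * ε ≤ c n * ε := by
        gcongr
        linarith
      linarith
    · rw [← mul_div_assoc, div_le_iff₀ hc0]
      linarith
  refine ⟨fun n => ?_, max (2 * B) (2 / ε) + ∑ i ∈ Finset.range (max n₁ k),
    pnorm c i (lam • (1 : Matrix (Fin i) (Fin i) ℂ) - T i)⁻¹, fun n => ?_⟩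
  · rcases lt_or_ge n (max n₁ k) with h | h
    · exact isUnit_of_not_hasEigenvalue (hev n h)
    · exact (hlarge n h).1
  · have hs : ∀ i ∈ Finset.range (max n₁ k),
        0 ≤ pnorm c i (lam • (1 : Matrix (Fin i) (Fin i) ℂ) - T i)⁻¹ := fun i _ => pnorm_nonneg c _
    rcases lt_or_ge n (max n₁ k) with h | h
    · refine (Finset.single_le_sum hs (Finset.mem_range.2 h)).trans ?_
      exact le_add_of_nonneg_left (le_max_of_le_left (by positivity))
    · exact (hlarge n h).2.trans (le_add_of_nonneg_right (Finset.sum_nonneg hs))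

end
end

section
/- If (a_n) ∈ A and a_n is a diagonal matrix in M_n(ℂ) for every n, then ‖a_n‖ → 0 as n → ∞. (Hence the diagonal Δ(A) of A equals the natural copy of the c₀-direct-sum of the diagonal algebras D_n inside A.) -/
noncomputable section

open scoped Matrix.Norms.L2Operator in
theorem opNorm_eq_l2_opNorm {n : ℕ} (x : Matrix (Fin n) (Fin n) ℂ) : opNorm x = ‖x‖ := by
  rw [Matrix.l2_opNorm_def]
  rfl

theorem norm_apply_le_opNorm {n : ℕ} (x : Matrix (Fin n) (Fin n) ℂ) (i j : Fin n) :
    ‖x i j‖ ≤ opNorm x := by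
  have h := (LinearMap.toContinuousLinearMap (Matrix.toEuclideanLin x)).le_opNorm
    (EuclideanSpace.single j 1)
  rw [PiLp.norm_single, norm_one, mul_one] at h
  refine le_trans ?_ h
  refine le_trans (le_of_eq ?_) (PiLp.norm_apply_le _ i)
  simp [Matrix.toLpLin_apply]

open scoped Matrix.Norms.L2Operator in
theorem opNorm_le_of_isDiag {n : ℕ} {x : Matrix (Fin n) (Fin n) ℂ} (hx : x.IsDiag) {r : ℝ}
    (hr : 0 ≤ r) (h : ∀ i, ‖x i i‖ ≤ r) : opNorm x ≤ r := by
  rw [opNorm_eq_l2_opNorm, ← hx.diagonal_diag, Matrix.l2_opNorm_diagonal]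
  exact (pi_norm_le_iff_of_nonneg hr).2 h

theorem Lmat_pow_apply_eq_zero {n : ℕ} (m : ℕ) (i j : Fin n) (h : (i : ℕ) + m ≠ j) :
    (Lmat n ^ m) i j = 0 := by
  induction m generalizing j with
  | zero => exact Matrix.one_apply_ne fun hij => h (by simp [hij])
  | succ m ih =>
    rw [pow_succ, Matrix.mul_apply]
    refine Finset.sum_eq_zero fun l _ => ?_
    by_cases hl : (i : ℕ) + m = l
    · have : (l : ℕ) + 1 ≠ j := by omega
      simp [Lmat, this]
    · rw [ih l hl, zero_mul]

theorem umat_apply_self {n k : ℕ} (hk : 0 < k) (hkn : k ≤ n) (i : Fin n) :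
    umat n k i i = 0 := by
  rw [umat, if_pos hkn, Matrix.smul_apply, Matrix.sum_apply,
    Finset.sum_eq_zero, smul_zero]
  intro m hm
  have hm_pos : (0 : ℝ) < m := by
    refine lt_of_lt_of_le ?_ (Finset.mem_filter.1 hm).2.1
    have : 0 < n := hk.trans_le hkn
    positivity
  have : 0 < m := by exact_mod_cast hm_pos
  exact Lmat_pow_apply_eq_zero m i i (by omega)

theorem norm_apply_self_le_pnorm {n k : ℕ} (c : ℕ → ℝ) (hk : 0 < k) (hkn : k ≤ n)
    {x : Matrix (Fin n) (Fin n) ℂ} (hx : x.IsDiag) (i : Fin n) :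
    ‖x i i‖ ≤ pnorm c n (x * umat n k - x) := by
  have h : (x * umat n k - x) i i = -x i i := by
    rw [Matrix.sub_apply, ← hx.diagonal_diag, Matrix.diagonal_mul, umat_apply_self hk hkn]
    simp
  rw [← norm_neg, ← h]
  exact (norm_apply_le_opNorm _ i i).trans (le_max_left _ _)

/-- If `(a_n) ∈ A` and `a_n` is a diagonal matrix in `M_n(ℂ)` for every
`n`, then `‖a_n‖ → 0` as `n → ∞`. -/
theorem stmt16 (c : ℕ → ℝ) (hmono : StrictMono c) (hone : ∀ n, 1 < c n)
    (hunbdd : ∀ M : ℝ, ∃ n, M < c n)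
    (a : ∀ n, Matrix (Fin n) (Fin n) ℂ) (ha : memA c a)
    (hdiag : ∀ n, ∀ i j : Fin n, i ≠ j → a n i j = 0) :
    Filter.Tendsto (fun n => opNorm (a n)) Filter.atTop (nhds 0) := by
  have hd : ∀ n, (a n).IsDiag := fun n i j hij => hdiag n i j hij
  rw [Metric.tendsto_atTop]
  intro ε hε
  obtain ⟨K, hK⟩ := ha.2 (ε / 2) (half_pos hε)
  refine ⟨max K 1, fun n hn => ?_⟩
  have hpos : 0 < max K 1 := by omega
  have hu := hK (max K 1) (le_max_left _ _) n
  have hnonneg : 0 ≤ pnorm c n (umat n (max K 1) * a n - a n) :=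
    le_max_of_le_left (norm_nonneg _)
  have hle : opNorm (a n) ≤ ε / 2 :=
    opNorm_le_of_isDiag (hd n) (half_pos hε).le fun i =>
      (norm_apply_self_le_pnorm c hpos hn (hd n) i).trans (by linarith)
  rw [Real.dist_eq, sub_zero, abs_of_nonneg (show 0 ≤ opNorm (a n) from norm_nonneg _)]
  linarith

end
end
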